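/- Let G be a vertex-weighted graph, let u be a vertex of G, and let A be the vertex set of a connected component of G−u. If w(u) + α(G[A ∖ N[u]]) ≤ α(G[A]), then α(G) = α(G₁) + α(G[A]), where G₁ = G − (A ∪ {u}) is the graph obtained from G by removing A and u. -/

import Mathlib

open scoped Classical

namespace MWIS

variable {V : Type*}

/-- A finset of vertices is an independent set of `G`. -/
def IsIndepSet (G : SimpleGraph V) (s : Finset V) : Prop :=
  ∀ ⦃a⦄, a ∈ s → ∀ ⦃b⦄, b ∈ s → ¬G.Adj a b

/-- The maximum total weight of an independent set of `G` contained in `A`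
(i.e. α of the induced subgraph `G[A]`, with the inherited weights). -/
noncomputable def alphaOn [Fintype V] (G : SimpleGraph V) (w : V → ℝ) (A : Finset V) : ℝ :=
  sSup {x : ℝ | ∃ s : Finset V, s ⊆ A ∧ IsIndepSet G s ∧ x = ∑ v ∈ s, w v}

/-- The maximum total weight of an independent set of `G`. -/
noncomputable def alpha [Fintype V] (G : SimpleGraph V) (w : V → ℝ) : ℝ :=
  alphaOn G w Finset.univ

/-- The open neighborhood of a vertex, as a finset. -/
noncomputable def nbrs [Fintype V] (G : SimpleGraph V) (v : V) : Finset V :=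
  Finset.univ.filter fun u => G.Adj v u

/-- The degree of a vertex. -/
noncomputable def deg [Fintype V] (G : SimpleGraph V) (v : V) : ℕ :=
  (nbrs G v).card

/-- The closed neighborhood `N[v]` of a vertex. -/
noncomputable def closedNbrs [Fintype V] [DecidableEq V] (G : SimpleGraph V) (v : V) : Finset V :=
  insert v (nbrs G v)

/-- The open neighborhood `N(A)` of a vertex set. -/
noncomputable def openNbhd [Fintype V] [DecidableEq V] (G : SimpleGraph V) (A : Finset V) :
    Finset V :=
  (A.biUnion fun v => nbrs G v) \ A

/-- The closed neighborhood `N[A]` of a vertex set. -/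
noncomputable def closedNbhd [Fintype V] [DecidableEq V] (G : SimpleGraph V) (A : Finset V) :
    Finset V :=
  A ∪ A.biUnion fun v => nbrs G v

/-- `s` is a maximum weighted independent set of `G` with weights `w`. -/
def IsMWIS [Fintype V] (G : SimpleGraph V) (w : V → ℝ) (s : Finset V) : Prop :=
  IsIndepSet G s ∧ ∀ t : Finset V, IsIndepSet G t → ∑ v ∈ t, w v ≤ ∑ v ∈ s, w v

/-- `A` is the vertex set of a connected component of the subgraph of `G` induced on `B`:
`A` is the set of vertices reachable from some `x ∈ B` by paths staying inside `B`. -/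
def IsCompOf (G : SimpleGraph V) (B A : Finset V) : Prop :=
  ∃ x ∈ B, ∀ y, y ∈ A ↔ Relation.ReflTransGen (fun a b => a ∈ B ∧ b ∈ B ∧ G.Adj a b) x y

lemma IsIndepSet.mono {G : SimpleGraph V} {s t : Finset V} (ht : IsIndepSet G t) (h : s ⊆ t) :
    IsIndepSet G s :=
  fun _ ha _ hb => ht (h ha) (h hb)

/-- Independent sets contained in `A` take only finitely many weights. -/
lemma finite_indepSet_weights [Fintype V] (G : SimpleGraph V) (w : V → ℝ) (A : Finset V) :
    {x : ℝ | ∃ s : Finset V, s ⊆ A ∧ IsIndepSet G s ∧ x = ∑ v ∈ s, w v}.Finite := by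
  refine (Set.finite_range fun t : Finset V => ∑ v ∈ t, w v).subset ?_
  rintro x ⟨t, -, -, rfl⟩
  exact ⟨t, rfl⟩

/-- Every independent set contained in `A` has weight at most `alphaOn G w A`. -/
lemma sum_le_alphaOn [Fintype V] (G : SimpleGraph V) (w : V → ℝ) {A s : Finset V}
    (hs : s ⊆ A) (hi : IsIndepSet G s) : ∑ v ∈ s, w v ≤ alphaOn G w A :=
  le_csSup (finite_indepSet_weights G w A).bddAbove ⟨s, hs, hi, rfl⟩

/-- `alphaOn G w A` is attained by some independent set contained in `A`. -/
lemma exists_sum_eq_alphaOn [Fintype V] (G : SimpleGraph V) (w : V → ℝ) (A : Finset V) :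
    ∃ s ⊆ A, IsIndepSet G s ∧ ∑ v ∈ s, w v = alphaOn G w A := by
  have hne : {x : ℝ | ∃ s : Finset V, s ⊆ A ∧ IsIndepSet G s ∧ x = ∑ v ∈ s, w v}.Nonempty :=
    ⟨_, ∅, Finset.empty_subset A, by simp [IsIndepSet], rfl⟩
  obtain ⟨s, hs, hi, h⟩ := hne.csSup_mem (finite_indepSet_weights G w A)
  exact ⟨s, hs, hi, h.symm⟩

lemma IsCompOf.subset {G : SimpleGraph V} {A B : Finset V} (hA : IsCompOf G B A) : A ⊆ B := by
  obtain ⟨x, hx, h⟩ := hA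
  intro y hy
  rcases Relation.ReflTransGen.cases_tail ((h y).1 hy) with rfl | ⟨c, -, hc⟩
  exacts [hx, hc.2.1]

/-- A component of `G[B]` is closed under adjacency within `B`. -/
lemma IsCompOf.mem_of_adj {G : SimpleGraph V} {A B : Finset V} (hA : IsCompOf G B A) {a b : V}
    (ha : a ∈ A) (hb : b ∈ B) (hab : G.Adj a b) : b ∈ A := by
  have haB := hA.subset ha
  obtain ⟨x, -, h⟩ := hA
  exact (h b).2 (((h a).1 ha).tail ⟨haB, hb, hab⟩)

/-- let `A` be the vertex set of a connected component of `G − u`.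
If `w(u) + α(G[A ∖ N[u]]) ≤ α(G[A])`, then `α(G) = α(G₁) + α(G[A])`, where
`G₁ = G − (A ∪ {u})`. -/
theorem stmt13 [Fintype V] [DecidableEq V] (G : SimpleGraph V) (w : V → ℝ)
    (hw : ∀ x, 0 < w x) (u : V) (A : Finset V)
    (hA : IsCompOf G (Finset.univ \ {u}) A)
    (hle : w u + alphaOn G w (A \ closedNbrs G u) ≤ alphaOn G w A) :
    alpha G w = alphaOn G w (Finset.univ \ insert u A) + alphaOn G w A := by
  have huA : u ∉ A := fun h => by simpa using hA.subset h
  apply le_antisymm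
  · obtain ⟨s, -, hi, hs⟩ := exists_sum_eq_alphaOn G w Finset.univ
    have hrest : ∑ v ∈ s \ insert u A, w v ≤ alphaOn G w (Finset.univ \ insert u A) :=
      sum_le_alphaOn G w (Finset.sdiff_subset_sdiff (Finset.subset_univ s) subset_rfl)
        (hi.mono Finset.sdiff_subset)
    have hcomp : ∑ v ∈ s ∩ insert u A, w v ≤ alphaOn G w A := by
      by_cases hu : u ∈ s
      · have hsub : s ∩ A ⊆ A \ closedNbrs G u := by
          intro v hv
          obtain ⟨hvs, hvA⟩ := Finset.mem_inter.1 hv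
          have hvu : v ≠ u := fun h => huA (h ▸ hvA)
          simp [closedNbrs, nbrs, hvA, hvu, hi hu hvs]
        have := sum_le_alphaOn G w hsub (hi.mono Finset.inter_subset_left)
        rw [Finset.inter_insert_of_mem hu, Finset.sum_insert (by simp [huA])]
        linarith
      · rw [Finset.inter_insert_of_notMem hu]
        exact sum_le_alphaOn G w Finset.inter_subset_right (hi.mono Finset.inter_subset_left)
    have hsplit := Finset.sum_inter_add_sum_sdiff s (insert u A) w
    rw [alpha, ← hs]
    linarith
  · obtain ⟨s, hsA, hsi, hs⟩ := exists_sum_eq_alphaOn G w (Finset.univ \ insert u A)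
    obtain ⟨t, htA, hti, ht⟩ := exists_sum_eq_alphaOn G w A
    have hsu : ∀ v ∈ s, v ≠ u ∧ v ∉ A := fun v hv => by simpa using hsA hv
    have hdisj : Disjoint s t :=
      Finset.disjoint_left.2 fun v hv hvt => (hsu v hv).2 (htA hvt)
    have hcross : ∀ a ∈ t, ∀ b ∈ s, ¬G.Adj a b := fun a ha b hb hab =>
      (hsu b hb).2 (hA.mem_of_adj (htA ha) (by simp [(hsu b hb).1]) hab)
    rw [← hs, ← ht, ← Finset.sum_union hdisj]
    refine sum_le_alphaOn G w (Finset.subset_univ _) fun a ha b hb hab => ?_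
    rcases Finset.mem_union.1 ha with ha | ha <;> rcases Finset.mem_union.1 hb with hb | hb
    exacts [hsi ha hb hab, hcross b hb a ha hab.symm, hcross a ha b hb hab, hti ha hb hab]

end MWIS
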